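/- Let λ > 0, let n_e : ℝ → ℝ be continuously differentiable with n_e'(s) > 0 for all s ∈ ℝ, let φ : [0,1] → ℝ be continuous, and let ρ : [0,1] → ℝ be Lebesgue integrable. Suppose W : [0,1] → ℝ is continuously differentiable with W(0) = W(1) = 0, and W' is absolutely continuous with a.e. derivative W'' ∈ L¹(0,1) satisfying −λ² W''(x) + n_e(φ(x) + W(x)) − n_e(φ(x)) = ρ(x) for a.e. x ∈ (0,1). Then λ² (∫₀¹ |W'(x)|² dx)^{1/2} ≤ ∫₀¹ |ρ(x)| dx. -/

import Mathlib

open MeasureTheory Set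

/-- Integration by parts for primitives of interval integrable functions. -/
theorem integral_mul_add_mul_eq_sub_of_primitive {f g F G : ℝ → ℝ} {a b : ℝ}
    (hf : IntervalIntegrable f volume a b) (hg : IntervalIntegrable g volume a b)
    (hF : ∀ x ∈ uIcc a b, F x = F a + ∫ t in a..x, f t)
    (hG : ∀ x ∈ uIcc a b, G x = G a + ∫ t in a..x, g t) :
    ∫ x in a..b, f x * G x + F x * g x = F b * G b - F a * G a := by
  have ac_const (c : ℝ) : AbsolutelyContinuousOnInterval (fun _ ↦ c) a b :=
    (LipschitzWith.const c).lipschitzOnWith.absolutelyContinuousOnInterval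
  have key := AbsolutelyContinuousOnInterval.integral_deriv_mul_eq_sub
    ((ac_const (F a)).add (hf.absolutelyContinuousOnInterval_intervalIntegral left_mem_uIcc))
    ((ac_const (G a)).add (hg.absolutelyContinuousOnInterval_intervalIntegral left_mem_uIcc))
  simp only [Pi.add_apply, intervalIntegral.integral_same, add_zero, ← hF b right_mem_uIcc,
    ← hG b right_mem_uIcc] at key
  rw [← key]
  apply intervalIntegral.integral_congr_ae
  filter_upwards [hf.ae_hasDerivAt_integral, hg.ae_hasDerivAt_integral] with x hfx hgx hx
  have hx' := uIoc_subset_uIcc hx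
  have hFx := ((hfx hx' a left_mem_uIcc).const_add (F a)).deriv
  have hGx := ((hgx hx' a left_mem_uIcc).const_add (G a)).deriv
  rw [hF x hx', hG x hx']
  exact congrArg₂ (· + ·) (congrArg (· * _) hFx.symm) (congrArg (_ * ·) hGx.symm)

/-- Cauchy–Schwarz inequality on the unit interval, tested against the constant `1`. -/
theorem integral_abs_le_sqrt_integral_sq {f : ℝ → ℝ}
    (hf : IntervalIntegrable (fun x ↦ |f x|) volume 0 1)
    (hf2 : IntervalIntegrable (fun x ↦ |f x| ^ 2) volume 0 1) :
    ∫ x in (0:ℝ)..1, |f x| ≤ Real.sqrt (∫ x in (0:ℝ)..1, |f x| ^ 2) := by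
  apply Real.le_sqrt_of_sq_le
  set c := ∫ x in (0:ℝ)..1, |f x| with hc
  have h := intervalIntegral.integral_mono_on (zero_le_one' ℝ)
    ((hf.const_mul (2 * c)).sub (intervalIntegrable_const (c := c ^ 2))) hf2
    (fun x _ ↦ by nlinarith [sq_nonneg (|f x| - c)])
  rw [intervalIntegral.integral_sub (hf.const_mul _) intervalIntegrable_const,
    intervalIntegral.integral_const_mul, ← hc, intervalIntegral.integral_const] at h
  simp only [sub_zero, one_smul] at h
  linarith

/-- `H¹` estimate `λ² ‖W'‖_{L²} ≤ ‖ρ‖_{L¹}` for a strong solution `W ∈ W^{2,1}(0,1)` of the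
nonlinear Poisson problem `-λ² W'' + n_e(φ + W) - n_e(φ) = ρ` with homogeneous
Dirichlet boundary conditions. -/
theorem nonlinear_poisson_H1_estimate (lam : ℝ) (hlam : 0 < lam)
    (ne : ℝ → ℝ) (hne : ContDiff ℝ 1 ne) (hne' : ∀ s : ℝ, 0 < deriv ne s)
    (phi : ℝ → ℝ) (hphi : ContinuousOn phi (Icc 0 1))
    (ρ : ℝ → ℝ) (hρ : IntegrableOn ρ (Icc 0 1))
    (W W' W'' : ℝ → ℝ)
    (hW : ∀ x ∈ Icc (0:ℝ) 1, HasDerivWithinAt W (W' x) (Icc 0 1) x)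
    (hW'cont : ContinuousOn W' (Icc 0 1))
    (hW''int : IntegrableOn W'' (Icc 0 1))
    (hAC : ∀ x ∈ Icc (0:ℝ) 1, W' x = W' 0 + ∫ t in (0:ℝ)..x, W'' t)
    (hb0 : W 0 = 0) (hb1 : W 1 = 0)
    (heq : ∀ᵐ x ∂(volume.restrict (Ioo (0:ℝ) 1)),
      -lam ^ 2 * W'' x + ne (phi x + W x) - ne (phi x) = ρ x) :
    lam ^ 2 * Real.sqrt (∫ x in (0:ℝ)..1, |W' x| ^ 2) ≤ ∫ x in (0:ℝ)..1, |ρ x| := by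
  have h01 : uIcc (0:ℝ) 1 = Icc 0 1 := uIcc_of_le zero_le_one
  have ii {f : ℝ → ℝ} (h : IntegrableOn f (Icc 0 1)) : IntervalIntegrable f volume 0 1 :=
    IntegrableOn.intervalIntegrable (h01 ▸ h)
  have iW' : IntervalIntegrable W' volume 0 1 := ii hW'cont.integrableOn_Icc
  have iW'a : IntervalIntegrable (fun x ↦ |W' x|) volume 0 1 := iW'.abs
  have iW'2 : IntervalIntegrable (fun x ↦ |W' x| ^ 2) volume 0 1 :=
    ii (hW'cont.abs.pow 2).integrableOn_Icc
  have iW'' := ii hW''int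
  have iρ := (ii hρ).abs
  have cW : ContinuousOn W (Icc 0 1) := fun x hx ↦ (hW x hx).continuousWithinAt
  have hprim : ∀ x ∈ Icc (0:ℝ) 1, W x = ∫ t in (0:ℝ)..x, W' t := by
    intro x hx
    have hsub : Icc 0 x ⊆ Icc (0:ℝ) 1 := Icc_subset_Icc_right hx.2
    rw [intervalIntegral.integral_eq_sub_of_hasDerivAt_of_le hx.1 (cW.mono hsub)
      (fun y hy ↦ (hW y (hsub (Ioo_subset_Icc_self hy))).hasDerivAt
        (Icc_mem_nhds hy.1 (hy.2.trans_le hx.2)))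
      (iW'.mono_set (by rwa [h01, uIcc_of_le hx.1])), hb0, sub_zero]
  set c := ∫ x in (0:ℝ)..1, |W' x| with hc
  have hWc : ∀ x ∈ Icc (0:ℝ) 1, |W x| ≤ c := by
    intro x hx
    rw [hprim x hx]
    exact (intervalIntegral.abs_integral_le_integral_abs hx.1).trans
      (intervalIntegral.integral_mono_interval le_rfl hx.1 hx.2
        (ae_of_all _ fun _ ↦ abs_nonneg _) iW'a)
  have hcs : c ≤ Real.sqrt (∫ x in (0:ℝ)..1, |W' x| ^ 2) :=
    integral_abs_le_sqrt_integral_sq iW'a iW'2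
  have parts : (∫ x in (0:ℝ)..1, W'' x * W x) = -∫ x in (0:ℝ)..1, |W' x| ^ 2 := by
    have h := integral_mul_add_mul_eq_sub_of_primitive (G := W) iW'' iW' (h01 ▸ hAC)
      (fun x hx ↦ by rw [hb0, zero_add]; exact hprim x (h01 ▸ hx))
    rw [hb0, hb1, intervalIntegral.integral_add (iW''.mul_continuousOn (h01 ▸ cW))
      (iW'.continuousOn_mul (h01 ▸ hW'cont))] at h
    simp only [sq, abs_mul_abs_self]
    linarith
  have hmono : StrictMono ne := strictMono_of_deriv_pos hne'
  have henergy : lam ^ 2 * ∫ x in (0:ℝ)..1, |W' x| ^ 2 ≤ c * ∫ x in (0:ℝ)..1, |ρ x| := by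
    have h : ∫ x in (0:ℝ)..1, -lam ^ 2 * (W'' x * W x) ≤ ∫ x in (0:ℝ)..1, c * |ρ x| := by
      refine intervalIntegral.integral_mono_ae_restrict zero_le_one
        ((iW''.mul_continuousOn (h01 ▸ cW)).const_mul _) (iρ.const_mul _) ?_
      rw [← restrict_Ioo_eq_restrict_Icc]
      filter_upwards [heq, ae_restrict_mem measurableSet_Ioo] with x hx hxm
      have hbd : ρ x * W x ≤ c * |ρ x| := by
        rw [mul_comm c]
        exact (le_abs_self _).trans (abs_mul (ρ x) (W x) ▸
          mul_le_mul_of_nonneg_left (hWc x (Ioo_subset_Icc_self hxm)) (abs_nonneg _))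
      have hsign : 0 ≤ (ne (phi x + W x) - ne (phi x)) * W x := by
        rcases le_total 0 (W x) with h | h
        · exact mul_nonneg (sub_nonneg.2 (hmono.monotone (by linarith))) h
        · exact mul_nonneg_of_nonpos_of_nonpos (sub_nonpos.2 (hmono.monotone (by linarith))) h
      rw [← hx] at hbd ⊢
      linarith
    rw [intervalIntegral.integral_const_mul, intervalIntegral.integral_const_mul, parts] at h
    linarith
  set A := Real.sqrt (∫ x in (0:ℝ)..1, |W' x| ^ 2)
  have hR : 0 ≤ ∫ x in (0:ℝ)..1, |ρ x| :=
    intervalIntegral.integral_nonneg zero_le_one fun _ _ ↦ abs_nonneg _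
  have hA2 : ∫ x in (0:ℝ)..1, |W' x| ^ 2 = A * A :=
    (Real.mul_self_sqrt (intervalIntegral.integral_nonneg zero_le_one fun _ _ ↦ sq_nonneg _)).symm
  rw [hA2] at henergy
  have hA0 : 0 ≤ A := Real.sqrt_nonneg _
  rcases hA0.eq_or_lt with h0 | hpos
  · rw [← h0, mul_zero]
    exact hR
  · refine le_of_mul_le_mul_right ?_ hpos
    nlinarith [mul_le_mul_of_nonneg_right hcs hR]
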